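/- arXiv:2005.14003 — 3 statements merged into one kernel-verified Lean document; each statement's English description precedes it below -/
import Mathlib

section
/- Suppose V ∩ K ≠ ∅ (Assumption 1) and there exist an index k and a scalar c > 0 such that every entry of the k-th row of A equals c (Assumption 2). Then the set of solutions to the problem 'minimize ‖ρ‖₁ subject to ρ ∈ V ∩ K' is exactly V ∩ K; i.e., every ρ* ∈ V ∩ K satisfies ‖ρ*‖₁ ≤ ‖ρ‖₁ for all ρ ∈ V ∩ K. -/
open Matrix BigOperators

/-- If row `k` of `A` is constantly `c`, then a nonnegative solution `ρ` of `A ρ = r` satisfies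
`c * ‖ρ‖₁ = r k`. -/
theorem mul_sum_abs_eq_of_const_row {ι κ : Type*} [Fintype κ]
    {A : Matrix ι κ ℝ} {r : ι → ℝ} {k : ι} {c : ℝ} (hrow : ∀ j, A k j = c)
    {ρ : κ → ℝ} (hρ : A.mulVec ρ = r) (hnonneg : ∀ j, 0 ≤ ρ j) :
    c * ∑ j, |ρ j| = r k := by
  simp only [← hρ, mulVec, dotProduct, hrow, abs_of_nonneg (hnonneg _), Finset.mul_sum]

/-- Under Assumptions 1 and 2, the set of solutions to the problem
`minimize ‖ρ‖₁ subject to ρ ∈ V ∩ K` is exactly V ∩ K; i.e., every ρ* ∈ V ∩ K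
satisfies ‖ρ*‖₁ ≤ ‖ρ‖₁ for all ρ ∈ V ∩ K. -/
theorem min_l1_solution_set_eq_feasible_set
    (D m : ℕ) (hD : 0 < D) (hm : 0 < m)
    (A : Matrix (Fin m) (Fin D) ℝ) (r : Fin m → ℝ)
    (K : Set (Fin D → ℝ)) (hK : K = {ρ | ∀ j, 0 ≤ ρ j})
    (V : Set (Fin D → ℝ)) (hV : V = {ρ | A.mulVec ρ = r})
    (hne : (V ∩ K).Nonempty)
    (k : Fin m) (c : ℝ) (hc : 0 < c) (hrow : ∀ j, A k j = c) :
    {ρ ∈ V ∩ K | ∀ σ ∈ V ∩ K, ∑ j, |ρ j| ≤ ∑ j, |σ j|} = V ∩ K := by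
  subst hK hV
  refine Set.sep_eq_self_iff_mem_true.mpr fun ρ hρ σ hσ => le_of_mul_le_mul_left ?_ hc
  rw [mul_sum_abs_eq_of_const_row hrow hρ.1 hρ.2, mul_sum_abs_eq_of_const_row hrow hσ.1 hσ.2]
end

section
/- (Proposition 1) Suppose V ∩ K ≠ ∅ (Assumption 1) and there exist an index k and a scalar c > 0 such that every entry of the k-th row of A equals c (Assumption 2). Then the following three sets coincide: (i) V ∩ K (the solution set of the feasibility problem); (ii) S := {ρ ∈ K : ‖Aρ − r‖₂² ≤ ‖Aσ − r‖₂² for all σ ∈ K} (the solution set of the nonnegative least squares problem); and (iii) {ρ ∈ V ∩ K : ‖ρ‖₁ ≤ ‖σ‖₁ for all σ ∈ V ∩ K} (the solution set of the minimum ℓ¹-norm problem over V ∩ K). -/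
open Matrix BigOperators

/-- Proposition 1: Under Assumptions 1 and 2, the solution sets of
(i) the feasibility problem (V ∩ K), (ii) the nonnegative least squares problem S,
and (iii) the minimum ℓ¹-norm problem over V ∩ K, all coincide. -/
theorem feasibility_nnls_l1_solution_sets_coincide
    (D m : ℕ) (hD : 0 < D) (hm : 0 < m)
    (A : Matrix (Fin m) (Fin D) ℝ) (r : Fin m → ℝ)
    (K : Set (Fin D → ℝ)) (hK : K = {ρ | ∀ j, 0 ≤ ρ j})
    (V : Set (Fin D → ℝ)) (hV : V = {ρ | A.mulVec ρ = r})
    (S : Set (Fin D → ℝ))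
    (hS : S = {ρ ∈ K | ∀ σ ∈ K,
      ∑ i, (A.mulVec ρ i - r i) ^ 2 ≤ ∑ i, (A.mulVec σ i - r i) ^ 2})
    (L : Set (Fin D → ℝ))
    (hL : L = {ρ ∈ V ∩ K | ∀ σ ∈ V ∩ K, ∑ j, |ρ j| ≤ ∑ j, |σ j|})
    (hne : (V ∩ K).Nonempty)
    (k : Fin m) (c : ℝ) (hc : 0 < c) (hrow : ∀ j, A k j = c) :
    V ∩ K = S ∧ V ∩ K = L := by
  subst hK hV hS hL
  have l1_eq : ∀ ρ ∈ {ρ | A.mulVec ρ = r} ∩ {ρ | ∀ j, 0 ≤ ρ j}, ∑ j, |ρ j| = r k / c := by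
    rintro ρ ⟨hρ, hpos⟩
    have hk : c * ∑ j, ρ j = r k := by
      rw [← congrFun hρ k, Finset.mul_sum]
      simp only [Matrix.mulVec, dotProduct, hrow]
    rw [Finset.sum_congr rfl fun j _ => abs_of_nonneg (hpos j), ← hk,
      mul_div_cancel_left₀ _ hc.ne']
  constructor
  · ext ρ
    constructor
    · rintro ⟨hρ, hpos⟩
      refine ⟨hpos, fun σ _ => ?_⟩
      rw [Set.mem_ofPred_eq] at hρ
      simpa [hρ] using Finset.sum_nonneg fun i _ => sq_nonneg (A.mulVec σ i - r i)
    · rintro ⟨hpos, hmin⟩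
      obtain ⟨σ, hσ, hσpos⟩ := hne
      rw [Set.mem_ofPred_eq] at hσ
      have hle : ∑ i, (A.mulVec ρ i - r i) ^ 2 ≤ 0 := by
        simpa [hσ] using hmin σ hσpos
      have hzero := (Finset.sum_eq_zero_iff_of_nonneg fun i _ => sq_nonneg _).1
        (hle.antisymm (Finset.sum_nonneg fun i _ => sq_nonneg _))
      exact ⟨funext fun i => sub_eq_zero.1 (pow_eq_zero_iff two_ne_zero |>.1
        (hzero i (Finset.mem_univ i))), hpos⟩
  · ext ρ
    exact ⟨fun hρ => ⟨hρ, fun σ hσ => (l1_eq ρ hρ).trans_le (l1_eq σ hσ).ge⟩, fun hρ => hρ.1⟩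
end

section
/- Suppose some row k of A has all entries strictly positive. Then the function ρ ↦ ‖Aρ − r‖₂² is coercive on the nonnegative orthant K: for every real number B there exists R > 0 such that every ρ ∈ K with ‖ρ‖₂ > R satisfies ‖Aρ − r‖₂² > B. -/
open Matrix BigOperators

/-- If some row k of A has all entries strictly positive, then
ρ ↦ ‖Aρ − r‖₂² is coercive on the nonnegative orthant K: for every B ∈ ℝ there
exists R > 0 such that every ρ ∈ K with ‖ρ‖₂ > R satisfies ‖Aρ − r‖₂² > B. -/
theorem nnls_objective_coercive_on_orthant
    (D m : ℕ) (hD : 0 < D) (hm : 0 < m)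
    (A : Matrix (Fin m) (Fin D) ℝ) (r : Fin m → ℝ)
    (K : Set (Fin D → ℝ)) (hK : K = {ρ | ∀ j, 0 ≤ ρ j})
    (k : Fin m) (hrow : ∀ j, 0 < A k j) :
    ∀ B : ℝ, ∃ R > 0, ∀ ρ ∈ K,
      Real.sqrt (∑ j, (ρ j) ^ 2) > R →
        ∑ i, (A.mulVec ρ i - r i) ^ 2 > B := by
  subst hK
  intro B
  have : Nonempty (Fin D) := ⟨⟨0, hD⟩⟩
  obtain ⟨j₀, hmin⟩ := Finite.exists_min (A k)
  have hc : 0 < A k j₀ := hrow j₀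
  refine ⟨(|r k| + |B| + 1) / A k j₀, by positivity, fun ρ hρ hR => ?_⟩
  have hnorm : Real.sqrt (∑ j, ρ j ^ 2) ≤ ∑ j, ρ j :=
    Real.sqrt_le_iff.mpr ⟨Finset.sum_nonneg fun j _ => hρ j,
      Finset.sum_sq_le_sq_sum_of_nonneg fun j _ => hρ j⟩
  have hlower : A k j₀ * ∑ j, ρ j ≤ A.mulVec ρ k := by
    rw [Finset.mul_sum]
    exact Finset.sum_le_sum fun j _ => mul_le_mul_of_nonneg_right (hmin j) (hρ j)
  have hlarge : |r k| + |B| + 1 < A k j₀ * ∑ j, ρ j :=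
    (div_lt_iff₀' hc).mp (hR.trans_le hnorm)
  have hresidual : |B| + 1 < A.mulVec ρ k - r k := by linarith [le_abs_self (r k)]
  calc B < (A.mulVec ρ k - r k) ^ 2 := by nlinarith [le_abs_self B, abs_nonneg B]
    _ ≤ ∑ i, (A.mulVec ρ i - r i) ^ 2 :=
      Finset.single_le_sum (f := fun i => (A.mulVec ρ i - r i) ^ 2)
        (fun i _ => sq_nonneg _) (Finset.mem_univ k)
end
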